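/- arXiv:1801.04583 — 2 statements merged into one kernel-verified Lean document; each statement's English description precedes it below -/
import Mathlib

section
/- Let X be a complete CAT(0) space, let F : X → ℝ be λ-convex and locally Lipschitz, and fix y ∈ X and A ≥ 0 such that for every ε > 0 there exists R > 0 with F(x) ≥ −(A+ε)·d(x,y)² whenever d(x,y) ≥ R. Fix x₀ ∈ X and s > 0 with s < 1/(16A) if A > 0. For n large enough that s/n > 0 and (if λ < 0) s/n < −1/(2λ), define x₀ⁿ(s) = x₀ and xᵢⁿ(s) = J(x_{i−1}ⁿ(s), s/n) for i = 1, …, n, where J(x,h) is the unique minimizer of z ↦ F(z) + d(x,z)²/(2h). Then the limit lim_{n→∞} xₙⁿ(s) exists and equals m(s), where m is the unique gradient curve of F with m(0) = x₀. -/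
open Metric Filter

/-- A geodesic (parametrized on `[0,1]`) in a metric space. -/
def IsGeodesic {X : Type*} [MetricSpace X] (γ : ℝ → X) : Prop :=
  ∀ s ∈ Set.Icc (0:ℝ) 1, ∀ t ∈ Set.Icc (0:ℝ) 1,
    dist (γ s) (γ t) = |s - t| * dist (γ 0) (γ 1)

/-- A geodesic metric space: any two points are joined by a geodesic. -/
def GeodesicMetricSpace (X : Type*) [MetricSpace X] : Prop :=
  ∀ x y : X, ∃ γ : ℝ → X, IsGeodesic γ ∧ γ 0 = x ∧ γ 1 = y

/-- CAT(0): geodesic space in which squared distance functions are 2-convex. -/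
def Cat0 (X : Type*) [MetricSpace X] : Prop :=
  GeodesicMetricSpace X ∧
  ∀ (y : X) (γ : ℝ → X), IsGeodesic γ → ∀ t ∈ Set.Icc (0:ℝ) 1,
    dist y (γ t) ^ 2 ≤ (1 - t) * dist y (γ 0) ^ 2 + t * dist y (γ 1) ^ 2
      - t * (1 - t) * dist (γ 0) (γ 1) ^ 2

/-- A geodesically convex subset. -/
def GeoConvex {X : Type*} [MetricSpace X] (Y : Set X) : Prop :=
  ∀ γ : ℝ → X, IsGeodesic γ → γ 0 ∈ Y → γ 1 ∈ Y → ∀ t ∈ Set.Icc (0:ℝ) 1, γ t ∈ Y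

/-- A `λ`-convex function on a metric space. -/
def LambdaConvex {X : Type*} [MetricSpace X] (lam : ℝ) (F : X → ℝ) : Prop :=
  ∀ γ : ℝ → X, IsGeodesic γ → ∀ t ∈ Set.Icc (0:ℝ) 1,
    F (γ t) ≤ (1 - t) * F (γ 0) + t * F (γ 1)
      - t * (1 - t) * (lam / 2) * dist (γ 0) (γ 1) ^ 2

/-- Locally Lipschitz on a subset. -/
def LocLipschitzOn {X Y : Type*} [MetricSpace X] [MetricSpace Y] (f : X → Y) (D : Set X) : Prop :=
  ∀ t ∈ D, ∃ K : NNReal, ∃ ε > 0, LipschitzOnWith K f (D ∩ Metric.ball t ε)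

/-- The (downward) absolute gradient `|∇₋F|(x)`. -/
noncomputable def absGradient {X : Type*} [MetricSpace X] (F : X → ℝ) (x : X) : ℝ :=
  max (Filter.limsup (fun y => (F x - F y) / dist x y) (nhdsWithin x {x}ᶜ)) 0

/-- `m` is a gradient curve of `F` at time `t`. -/
def IsGradientCurveAt {X : Type*} [MetricSpace X] (F : X → ℝ) (m : ℝ → X) (t : ℝ) : Prop :=
  Filter.Tendsto (fun ε : ℝ => dist (m (t + ε)) (m t) / ε) (nhdsWithin 0 (Set.Ioi 0))
    (nhds (absGradient F (m t))) ∧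
  Filter.Tendsto (fun ε : ℝ => (F (m (t + ε)) - F (m t)) / ε) (nhdsWithin 0 (Set.Ioi 0))
    (nhds (-(absGradient F (m t)) ^ 2))


/-- The domain of the gradient curve: `[0,∞)` if `A = 0`, `[0, 1/(16A)]` if `A > 0`. -/
noncomputable def GradDomain (A : ℝ) : Set ℝ :=
  if A = 0 then Set.Ici 0 else Set.Icc 0 (1 / (16 * A))

/-- `m` is a locally Lipschitz gradient curve of `F` starting at `x₀`,
defined on `GradDomain A`, which is a gradient curve at every `t ∈ GradDomain A`
with `t < sup (GradDomain A)`. -/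
def IsGradSolution {X : Type*} [MetricSpace X] (F : X → ℝ) (A : ℝ) (x₀ : X)
    (m : ℝ → X) : Prop :=
  m 0 = x₀ ∧ LocLipschitzOn m (GradDomain A) ∧
  ∀ t ∈ GradDomain A, (A = 0 ∨ t < 1 / (16 * A)) → IsGradientCurveAt F m t

theorem IsGeodesic.dist_left {X : Type*} [MetricSpace X] {γ : ℝ → X} (hγ : IsGeodesic γ)
    {t : ℝ} (ht : t ∈ Set.Icc (0:ℝ) 1) : dist (γ 0) (γ t) = t * dist (γ 0) (γ 1) := by
  rw [hγ 0 (by simp) t ht, zero_sub, abs_neg, abs_of_nonneg ht.1]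

theorem LambdaConvex.mono {X : Type*} [MetricSpace X] {lam lam' : ℝ} {F : X → ℝ}
    (hF : LambdaConvex lam F) (h : lam' ≤ lam) : LambdaConvex lam' F := by
  intro γ hγ t ht
  refine (hF γ hγ t ht).trans ?_
  have h1 : 0 ≤ t * (1 - t) := mul_nonneg ht.1 (sub_nonneg.2 ht.2)
  have h2 : 0 ≤ t * (1 - t) * dist (γ 0) (γ 1) ^ 2 := by positivity
  nlinarith

theorem absGradient_nonneg {X : Type*} [MetricSpace X] (F : X → ℝ) (x : X) :
    0 ≤ absGradient F x := le_max_right _ _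

/-- For a locally Lipschitz function, the descending difference quotients are eventually below any
number exceeding the absolute gradient. -/
theorem eventually_quotient_lt_of_absGradient_lt {X : Type*} [MetricSpace X] {F : X → ℝ}
    (hlip : LocallyLipschitz F) {x : X} {c : ℝ} (hc : absGradient F x < c) :
    ∀ᶠ y in nhdsWithin x {x}ᶜ, (F x - F y) / dist x y < c := by
  refine eventually_lt_of_limsup_lt ((le_max_left _ _).trans_lt hc) ?_
  obtain ⟨K, U, hU, hK⟩ := hlip x
  refine ⟨K, ?_⟩
  rw [eventually_map]
  filter_upwards [nhdsWithin_le_nhds hU] with y hy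
  have h := hK.dist_le_mul x (mem_of_mem_nhds hU) y hy
  rw [Real.dist_eq] at h
  exact div_le_of_le_mul₀ dist_nonneg K.coe_nonneg ((le_abs_self _).trans h)

theorem LambdaConvex.sub_le_absGradient {X : Type*} [MetricSpace X] (hX : Cat0 X)
    {lam : ℝ} {F : X → ℝ} (hconv : LambdaConvex lam F) (hlip : LocallyLipschitz F) (x w : X) :
    F x - F w ≤ absGradient F x * dist x w - lam / 2 * dist x w ^ 2 := by
  rcases eq_or_ne x w with rfl | hne
  · simp
  have hd : 0 < dist x w := dist_pos.2 hne
  obtain ⟨γ, hγ, h0, h1⟩ := hX.1 x w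
  suffices h : (F x - F w) / dist x w + lam / 2 * dist x w ≤ absGradient F x by
    have := mul_le_mul_of_nonneg_right h hd.le
    rw [add_mul, div_mul_cancel₀ _ hd.ne'] at this
    linarith
  refine le_of_forall_gt_imp_ge_of_dense fun c hc => ?_
  have hdist : ∀ t ∈ Set.Icc (0:ℝ) 1, dist x (γ t) = t * dist x w := fun t ht => by
    have := hγ.dist_left ht
    rwa [h0, h1] at this
  have hmem : ∀ᶠ t in nhdsWithin (0:ℝ) (Set.Ioi 0), t ∈ Set.Ioc (0:ℝ) 1 :=
    Ioc_mem_nhdsGT one_pos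
  have hlim : Tendsto γ (nhdsWithin 0 (Set.Ioi 0)) (nhdsWithin x {x}ᶜ) := by
    refine tendsto_nhdsWithin_iff.2 ⟨tendsto_iff_dist_tendsto_zero.2 ?_, ?_⟩
    · have h : Tendsto (fun t : ℝ => t * dist x w) (nhdsWithin 0 (Set.Ioi 0)) (nhds 0) := by
        have : Tendsto (fun t : ℝ => t * dist x w) (nhds 0) (nhds (0 * dist x w)) :=
          (continuous_id.mul continuous_const).tendsto 0
        rw [zero_mul] at this
        exact this.mono_left nhdsWithin_le_nhds
      refine h.congr' ?_
      filter_upwards [hmem] with t ht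
      rw [dist_comm (γ t), hdist t ⟨ht.1.le, ht.2⟩]
    · filter_upwards [hmem] with t ht h
      have := hdist t ⟨ht.1.le, ht.2⟩
      rw [h, dist_self] at this
      exact (mul_pos ht.1 hd).ne this
  have hev := hlim.eventually (eventually_quotient_lt_of_absGradient_lt hlip hc)
  have hl : Tendsto (fun t : ℝ => (F x - F w) / dist x w + (1 - t) * (lam / 2) * dist x w)
      (nhdsWithin 0 (Set.Ioi 0)) (nhds ((F x - F w) / dist x w + lam / 2 * dist x w)) := by
    have : Continuous fun t : ℝ => (F x - F w) / dist x w + (1 - t) * (lam / 2) * dist x w := by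
      fun_prop
    have := this.tendsto 0
    simp only [sub_zero, one_mul] at this
    exact this.mono_left nhdsWithin_le_nhds
  refine le_of_tendsto hl ?_
  filter_upwards [hmem, hev] with t ht hlt
  refine le_trans ?_ hlt.le
  have hcv := hconv γ hγ t ⟨ht.1.le, ht.2⟩
  rw [h0, h1] at hcv
  have ht0 := ht.1
  rw [hdist t ⟨ht.1.le, ht.2⟩, le_div_iff₀ (mul_pos ht.1 hd)]
  have : ((F x - F w) / dist x w + (1 - t) * (lam / 2) * dist x w) * (t * dist x w)
      = t * (F x - F w) + t * (1 - t) * (lam / 2) * dist x w ^ 2 := by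
    field_simp
  linarith

/-- The discrete evolution variational inequality for a proximal step. -/
theorem LambdaConvex.proximal_evi {X : Type*} [MetricSpace X] (hX : Cat0 X)
    {lam : ℝ} {F : X → ℝ} (hconv : LambdaConvex lam F) {h : ℝ} (hh : 0 < h) {p q : X}
    (hmin : ∀ w, F q + dist p q ^ 2 / (2 * h) ≤ F w + dist p w ^ 2 / (2 * h)) (w : X) :
    (1 + lam * h) * dist q w ^ 2 ≤ dist p w ^ 2 + 2 * h * (F w - F q) := by
  obtain ⟨γ, hγ, h0, h1⟩ := hX.1 q w
  have hl : Tendsto (fun t : ℝ => (1 - t) * ((1 + lam * h) * dist q w ^ 2))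
      (nhdsWithin 0 (Set.Ioi 0)) (nhds ((1 + lam * h) * dist q w ^ 2)) := by
    have : Continuous fun t : ℝ => (1 - t) * ((1 + lam * h) * dist q w ^ 2) := by fun_prop
    have := this.tendsto 0
    simp only [sub_zero, one_mul] at this
    exact this.mono_left nhdsWithin_le_nhds
  refine le_of_tendsto hl ?_
  have hmem : ∀ᶠ t in nhdsWithin (0:ℝ) (Set.Ioi 0), t ∈ Set.Ioc (0:ℝ) 1 :=
    Ioc_mem_nhdsGT one_pos
  filter_upwards [hmem] with t ht
  have ht' : t ∈ Set.Icc (0:ℝ) 1 := ⟨ht.1.le, ht.2⟩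
  have hc := hconv γ hγ t ht'
  have hd := hX.2 p γ hγ t ht'
  have hm := hmin (γ t)
  rw [h0, h1] at hc hd
  have hm' : 2 * h * F q + dist p q ^ 2 ≤ 2 * h * F (γ t) + dist p (γ t) ^ 2 := by
    have := mul_le_mul_of_nonneg_left hm (by positivity : 0 ≤ 2 * h)
    field_simp at this
    linarith
  have hc' := mul_le_mul_of_nonneg_left hc (by positivity : 0 ≤ 2 * h)
  refine le_of_mul_le_mul_left ?_ ht.1
  nlinarith [mul_nonneg ht.1.le (sq_nonneg (dist p q))]

/-- A gradient curve of a `λ`-convex function satisfies the evolution variational inequality. -/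
theorem IsGradientCurveAt.evi {X : Type*} [MetricSpace X] (hX : Cat0 X)
    {lam : ℝ} {F : X → ℝ} (hconv : LambdaConvex lam F) (hlip : LocallyLipschitz F)
    {m : ℝ → X} {t : ℝ} (hm : IsGradientCurveAt F m t) (w : X) {c : ℝ}
    (hc : 2 * (F w - F (m t)) - lam * dist (m t) w ^ 2 < c) :
    ∀ᶠ ε in nhdsWithin (0:ℝ) (Set.Ioi 0),
      (dist (m (t + ε)) w ^ 2 - dist (m t) w ^ 2) / ε < c := by
  set x := m t with hx
  set g := absGradient F x with hg
  set l := nhdsWithin (0:ℝ) (Set.Ioi 0) with hl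
  obtain ⟨hr, hQ⟩ := hm
  rw [← hx, ← hg] at hr hQ
  obtain ⟨δ, hδ0, hδ⟩ : ∃ δ > 0,
      2 * (F w - F x) - lam * dist x w ^ 2 + δ * dist x w ^ 2 < c := by
    have : Tendsto (fun δ : ℝ => 2 * (F w - F x) - lam * dist x w ^ 2 + δ * dist x w ^ 2)
        l (nhds (2 * (F w - F x) - lam * dist x w ^ 2)) := by
      have : Continuous fun δ : ℝ =>
          2 * (F w - F x) - lam * dist x w ^ 2 + δ * dist x w ^ 2 := by fun_prop
      have := this.tendsto 0
      simp only [zero_mul, add_zero] at this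
      exact this.mono_left nhdsWithin_le_nhds
    obtain ⟨δ, h1, h2⟩ := ((this.eventually_lt_const hc).and self_mem_nhdsWithin).exists
    exact ⟨δ, h2, h1⟩
  have hε : Tendsto (fun ε : ℝ => ε) l (nhds 0) := tendsto_id.mono_left nhdsWithin_le_nhds
  have hz : Tendsto (fun ε => m (t + ε)) l (nhds x) := by
    refine tendsto_iff_dist_tendsto_zero.2 ?_
    have := hr.mul hε
    rw [mul_zero] at this
    refine this.congr' ?_
    filter_upwards [self_mem_nhdsWithin] with ε hpos
    exact div_mul_cancel₀ _ (ne_of_gt hpos)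
  have hD : Tendsto (fun ε => dist (m (t + ε)) w) l (nhds (dist x w)) :=
    hz.dist tendsto_const_nhds
  have h1 : Tendsto (fun ε : ℝ => 1 + lam * ε) l (nhds 1) := by
    simpa using (hε.const_mul lam).const_add 1
  have h2 : Tendsto (fun ε : ℝ => 1 - ε * δ) l (nhds 1) := by
    simpa using (hε.mul_const δ).const_sub 1
  have hlim : Tendsto (fun ε : ℝ => 2 / δ * (g ^ 2 / (2 * (1 + lam * ε))
      + (1 - ε * δ) * ((F (m (t + ε)) - F x) / ε + (dist (m (t + ε)) x / ε) ^ 2 / 2)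
      + δ * (F w - F x) - δ * (1 - ε * δ) * (lam / 2) * dist (m (t + ε)) w ^ 2
      + δ ^ 2 * dist (m (t + ε)) w ^ 2 / 2)) l
      (nhds (2 / δ * (g ^ 2 / (2 * 1) + 1 * (-g ^ 2 + g ^ 2 / 2)
      + δ * (F w - F x) - δ * 1 * (lam / 2) * dist x w ^ 2 + δ ^ 2 * dist x w ^ 2 / 2))) := by
    refine Tendsto.const_mul _ ?_
    refine ((((tendsto_const_nhds.div (h1.const_mul 2) (by norm_num)).add
      (h2.mul (hQ.add ((hr.pow 2).div_const 2)))).add_const _).sub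
      (((h2.const_mul δ).mul_const _).mul (hD.pow 2))).add
      (((hD.pow 2).const_mul _).div_const _)
  have hval : 2 / δ * (g ^ 2 / (2 * 1) + 1 * (-g ^ 2 + g ^ 2 / 2)
      + δ * (F w - F x) - δ * 1 * (lam / 2) * dist x w ^ 2 + δ ^ 2 * dist x w ^ 2 / 2) =
      2 * (F w - F x) - lam * dist x w ^ 2 + δ * dist x w ^ 2 := by
    field_simp
    ring
  rw [hval] at hlim
  filter_upwards [hlim.eventually_lt_const hδ, self_mem_nhdsWithin,
    h1.eventually_const_lt one_pos, h2.eventually_const_lt one_pos] with ε hlt hpos hp1 hp2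
  refine lt_of_le_of_lt ?_ hlt
  replace hpos : 0 < ε := hpos
  obtain ⟨γ, hγ, h0, h1'⟩ := hX.1 (m (t + ε)) w
  have hτ : ε * δ ∈ Set.Icc (0:ℝ) 1 := ⟨by positivity, by linarith⟩
  have hcv := hconv γ hγ _ hτ
  have hcat := hX.2 x γ hγ _ hτ
  have hsl := hconv.sub_le_absGradient hX hlip x (γ (ε * δ))
  rw [h0, h1'] at hcv hcat
  rw [← hg] at hsl
  set z := m (t + ε)
  set D := dist z w
  set Q := (F z - F x) / ε with hQdef
  set r := dist z x / ε with hrdef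
  have hFz : F z = F x + ε * Q := by rw [hQdef]; field_simp; ring
  have hdz : dist x z = ε * r := by rw [hrdef, dist_comm]; field_simp
  rw [hFz] at hcv
  rw [hdz] at hcat
  set a := dist x (γ (ε * δ))
  have hquad : -(ε * (g ^ 2 / (2 * (1 + lam * ε)))) ≤ -(g * a) + (1 + lam * ε) / (2 * ε) * a ^ 2 := by
    have : -(g * a) + (1 + lam * ε) / (2 * ε) * a ^ 2 + ε * (g ^ 2 / (2 * (1 + lam * ε)))
        = ((1 + lam * ε) * a - ε * g) ^ 2 / (2 * ε * (1 + lam * ε)) := by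
      field_simp
      ring
    have h3 : 0 ≤ ((1 + lam * ε) * a - ε * g) ^ 2 / (2 * ε * (1 + lam * ε)) := by positivity
    linarith
  have hsplit : (1 + lam * ε) / (2 * ε) * a ^ 2 = a ^ 2 / (2 * ε) + lam / 2 * a ^ 2 := by
    field_simp
  have hcat' := div_le_div_of_nonneg_right hcat (by positivity : 0 ≤ 2 * ε)
  have key : -(ε * (g ^ 2 / (2 * (1 + lam * ε)))) ≤
      (1 - ε * δ) * (ε * Q) + ε * δ * (F w - F x) - ε * δ * (1 - ε * δ) * (lam / 2) * D ^ 2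
      + ((1 - ε * δ) * (ε * r) ^ 2 + ε * δ * dist x w ^ 2 - ε * δ * (1 - ε * δ) * D ^ 2)
        / (2 * ε) := by
    linarith
  have hfin : (ε * δ / 2) * ((D ^ 2 - dist x w ^ 2) / ε) ≤ (ε * δ / 2) * (2 / δ *
      (g ^ 2 / (2 * (1 + lam * ε)) + (1 - ε * δ) * (Q + r ^ 2 / 2)
      + δ * (F w - F x) - δ * (1 - ε * δ) * (lam / 2) * D ^ 2 + δ ^ 2 * D ^ 2 / 2)) := by
    have e1 : (ε * δ / 2) * ((D ^ 2 - dist x w ^ 2) / ε) = δ / 2 * (D ^ 2 - dist x w ^ 2) := by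
      field_simp
    have e2 : ∀ Y : ℝ, (ε * δ / 2) * (2 / δ * Y) = ε * Y := fun Y => by field_simp
    have e3 : ((1 - ε * δ) * (ε * r) ^ 2 + ε * δ * dist x w ^ 2 - ε * δ * (1 - ε * δ) * D ^ 2)
        / (2 * ε) = (1 - ε * δ) * ε * r ^ 2 / 2 + δ * dist x w ^ 2 / 2
          - δ * (1 - ε * δ) * D ^ 2 / 2 := by
      field_simp
    rw [e1, e2]
    rw [e3] at key
    linarith
  exact le_of_mul_le_mul_left hfin (by positivity)

/-- Proximal iterates move away from the starting point at most linearly in time. -/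
theorem LambdaConvex.dist_proximal_iterate_le {X : Type*} [MetricSpace X] (hX : Cat0 X)
    {μ : ℝ} (hμ : 0 ≤ μ) {F : X → ℝ} (hconv : LambdaConvex (-μ) F) (hlip : LocallyLipschitz F)
    {h : ℝ} (hh : 0 < h) (hhμ : 4 * μ * h ≤ 1) {n : ℕ} {u : ℕ → X}
    (hmin : ∀ i < n, ∀ w, F (u (i + 1)) + dist (u i) (u (i + 1)) ^ 2 / (2 * h) ≤
      F w + dist (u i) w ^ 2 / (2 * h)) :
    ∀ i ≤ n, dist (u i) (u 0) ≤
      2 * absGradient F (u 0) * (i * h) * Real.exp (4 * μ * (i * h)) := by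
  have hg := absGradient_nonneg F (u 0)
  set g := absGradient F (u 0) with hgdef
  intro i
  induction i with
  | zero => simp
  | succ i ih =>
    intro hi
    have ih := ih (by omega)
    have hevi := hconv.proximal_evi hX hh (hmin i (by omega)) (u 0)
    have hsl := hconv.sub_le_absGradient hX hlip (u 0) (u (i + 1))
    rw [← hgdef, dist_comm (u 0)] at hsl
    set a := dist (u (i + 1)) (u 0)
    set b := dist (u i) (u 0)
    have ha : 0 ≤ a := dist_nonneg
    have hb : 0 ≤ b := dist_nonneg
    have h1 : (1 - 2 * μ * h) * a ^ 2 ≤ b ^ 2 + 2 * h * g * a := by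
      have := mul_le_mul_of_nonneg_left hsl (by positivity : 0 ≤ 2 * h)
      nlinarith
    have h2 : (1 - 2 * μ * h) * a ≤ b + 2 * h * g := by
      have hμh : 0 ≤ μ * h := by positivity
      have hhg : 0 ≤ h * g := by positivity
      rcases le_or_gt a b with hab | hab
      · nlinarith
      · have ha' : 0 < a := hb.trans_lt hab
        refine le_of_mul_le_mul_right ?_ ha'
        nlinarith
    have hμh : 0 ≤ μ * h := by positivity
    have h3 : a ≤ (b + 2 * h * g) * Real.exp (4 * μ * h) := by
      have he : 1 ≤ (1 - 2 * μ * h) * Real.exp (4 * μ * h) := by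
        have := Real.add_one_le_exp (4 * μ * h)
        nlinarith
      calc a = a * 1 := (mul_one a).symm
        _ ≤ a * ((1 - 2 * μ * h) * Real.exp (4 * μ * h)) := by gcongr
        _ = (1 - 2 * μ * h) * a * Real.exp (4 * μ * h) := by ring
        _ ≤ _ := by gcongr
    have h4 : (1:ℝ) ≤ Real.exp (4 * μ * (i * h)) := Real.one_le_exp (by positivity)
    calc a ≤ (b + 2 * h * g) * Real.exp (4 * μ * h) := h3
      _ ≤ (2 * g * (i * h) * Real.exp (4 * μ * (i * h)) +
            2 * h * g * Real.exp (4 * μ * (i * h))) * Real.exp (4 * μ * h) := by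
          have h5 : 2 * h * g ≤ 2 * h * g * Real.exp (4 * μ * (i * h)) :=
            le_mul_of_one_le_right (by positivity) h4
          gcongr
      _ = 2 * g * ((i + 1 : ℕ) * h) *
            (Real.exp (4 * μ * (i * h)) * Real.exp (4 * μ * h)) := by push_cast; ring
      _ = _ := by rw [← Real.exp_add]; push_cast; ring_nf

/-- Comparison of proximal iterates with a gradient curve, by doubling the time variable. -/
theorem LambdaConvex.dist_sq_proximal_gradientCurve_le {X : Type*} [MetricSpace X] (hX : Cat0 X)
    {μ : ℝ} (hμ : 0 ≤ μ) {F : X → ℝ} (hconv : LambdaConvex (-μ) F) (hlip : LocallyLipschitz F)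
    {h s C : ℝ} (hh : 0 < h) (hC : 0 < C) {n : ℕ} {u : ℕ → X} {m : ℝ → X}
    (hmin : ∀ i < n, ∀ w, F (u (i + 1)) + dist (u i) (u (i + 1)) ^ 2 / (2 * h) ≤
      F w + dist (u i) w ^ 2 / (2 * h))
    (hcont : ContinuousOn m (Set.Icc 0 s))
    (hm : ∀ t ∈ Set.Ico 0 s, IsGradientCurveAt F m t)
    (hm0 : ∀ t ∈ Set.Icc 0 s, dist (m t) (u 0) ^ 2 ≤ C * t ^ 2)
    (hu0 : ∀ i ≤ n, dist (m 0) (u i) ^ 2 ≤ C * (i * h) ^ 2) :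
    ∀ i ≤ n, ∀ t ∈ Set.Icc 0 s, dist (m t) (u i) ^ 2 ≤
      C * Real.exp (2 * μ * t) * ((t - i * h) ^ 2 + 2 * h * t) := by
  intro i
  induction i with
  | zero =>
    intro _ t ht
    refine (hm0 t ht).trans ?_
    have h1 : (1:ℝ) ≤ Real.exp (2 * μ * t) := Real.one_le_exp (mul_nonneg (by positivity) ht.1)
    have ht0 := ht.1
    calc C * t ^ 2 ≤ C * 1 * (t ^ 2 + 2 * h * t) := by
          rw [mul_one]; gcongr; exact le_add_of_nonneg_right (by positivity)
      _ ≤ C * Real.exp (2 * μ * t) * (t ^ 2 + 2 * h * t) := by gcongr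
      _ = _ := by simp
  | succ i ih =>
    intro hi
    have ih := ih (by omega)
    set c : ℝ := ((i + 1 : ℕ) : ℝ) * h with hc
    have hci : (i : ℝ) * h = c - h := by rw [hc]; push_cast; ring
    have hB : ∀ t : ℝ, HasDerivAt
        (fun t => C * Real.exp (2 * μ * t) * ((t - c) ^ 2 + 2 * h * t))
        (C * Real.exp (2 * μ * t) * (2 * μ * ((t - c) ^ 2 + 2 * h * t) + 2 * (t - c) + 2 * h))
        t := by
      intro t
      have e1 : HasDerivAt (fun t : ℝ => C * Real.exp (2 * μ * t))
          (C * (Real.exp (2 * μ * t) * (2 * μ * 1))) t :=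
        (((hasDerivAt_id t).const_mul (2 * μ)).exp).const_mul C
      have e2 : HasDerivAt (fun t : ℝ => (t - c) ^ 2 + 2 * h * t)
          ((2:ℕ) * (t - c) ^ (2 - 1) * 1 + 2 * h * 1) t :=
        (((hasDerivAt_id t).sub_const c).pow 2).add ((hasDerivAt_id t).const_mul (2 * h))
      refine (e1.mul e2).congr_deriv ?_
      push_cast
      ring
    refine image_le_of_liminf_slope_right_lt_deriv_boundary
      (f := fun t => dist (m t) (u (i + 1)) ^ 2)
      (f' := fun t => 2 * (F (u (i + 1)) - F (m t)) - (-μ) * dist (m t) (u (i + 1)) ^ 2)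
      (ContinuousOn.pow (fun t ht => (hcont t ht).dist tendsto_const_nhds) 2) ?_ ?_ hB ?_
    · intro t ht r hr
      have hev := (hm t ht).evi hX hconv hlip (u (i + 1)) hr
      have htr : Tendsto (fun z : ℝ => z - t) (nhdsWithin t (Set.Ioi t))
          (nhdsWithin 0 (Set.Ioi 0)) := by
        refine tendsto_nhdsWithin_iff.2 ⟨?_, ?_⟩
        · have := (continuous_sub_right t).tendsto t
          rw [sub_self] at this
          exact this.mono_left nhdsWithin_le_nhds
        · filter_upwards [self_mem_nhdsWithin] with z hz
          exact sub_pos.2 (Set.mem_Ioi.1 hz)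
      refine Eventually.frequently ?_
      filter_upwards [htr.eventually hev] with z hz
      rw [add_sub_cancel] at hz
      rwa [slope_def_field]
    · have := hu0 (i + 1) hi
      rw [← hc] at this
      simpa using this
    · intro t ht heq
      have ht' : t ∈ Set.Icc 0 s := ⟨ht.1, ht.2.le⟩
      have hprev := ih t ht'
      have hevi := hconv.proximal_evi hX hh (hmin i (by omega)) (m t)
      rw [dist_comm _ (m t), dist_comm _ (m t)] at hevi
      rw [hci] at hprev
      have hpos : 0 < C * Real.exp (2 * μ * t) := by positivity
      set W := C * Real.exp (2 * μ * t)
      refine lt_of_mul_lt_mul_left ?_ hh.le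
      rw [heq] at hevi ⊢
      have hWh : 0 < W * h ^ 2 := by positivity
      nlinarith

theorem stmt6 {X : Type*} [MetricSpace X] [CompleteSpace X] (hX : Cat0 X)
    (lam : ℝ) (F : X → ℝ) (hconv : LambdaConvex lam F) (hlip : LocallyLipschitz F)
    (y : X) (A : ℝ) (hA : 0 ≤ A)
    (hgrowth : ∀ ε > 0, ∃ R > 0, ∀ x : X, R ≤ dist x y →
      -(A + ε) * dist x y ^ 2 ≤ F x)
    (x₀ : X) (s : ℝ) (hs : 0 < s) (hsA : 0 < A → s < 1 / (16 * A))
    (x : ℕ → ℕ → X) (hx0 : ∀ n, x n 0 = x₀)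
    (hstep : ∀ n : ℕ, 0 < (s / n : ℝ) → (lam < 0 → (s / n : ℝ) < -1 / (2 * lam)) →
      ∀ i < n, ∀ w : X,
        F (x n (i + 1)) + dist (x n i) (x n (i + 1)) ^ 2 / (2 * (s / n)) ≤
          F w + dist (x n i) w ^ 2 / (2 * (s / n)))
    (m : ℝ → X) (hm : IsGradSolution F A x₀ m) :
    Filter.Tendsto (fun n : ℕ => x n n) Filter.atTop (nhds (m s)) := by
  obtain ⟨hm0, hmlip, hmgrad⟩ := hm
  have hdom : Set.Icc 0 s ⊆ GradDomain A := by
    intro t ht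
    unfold GradDomain
    split_ifs with h
    · exact ht.1
    · exact ⟨ht.1, ht.2.trans (hsA (lt_of_le_of_ne hA (Ne.symm h))).le⟩
  have hgrad : ∀ t ∈ Set.Ico 0 s, IsGradientCurveAt F m t := by
    intro t ht
    refine hmgrad t (hdom ⟨ht.1, ht.2.le⟩) ?_
    rcases hA.eq_or_lt with h | h
    · exact Or.inl h.symm
    · exact Or.inr (ht.2.trans (hsA h))
  have hcont : ContinuousOn m (Set.Icc 0 s) := by
    refine ContinuousOn.mono (fun t ht => ?_) hdom
    obtain ⟨K, ε, hε, hK⟩ := hmlip t ht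
    exact (hK.continuousOn t ⟨ht, mem_ball_self hε⟩).mono_of_mem_nhdsWithin
      (inter_mem_nhdsWithin _ (ball_mem_nhds t hε))
  obtain ⟨L, hL0, hL⟩ : ∃ L ≥ 0, ∀ t ∈ Set.Icc 0 s, dist (m t) x₀ ≤ L * t := by
    have h0 : (0:ℝ) ∈ GradDomain A := hdom ⟨le_rfl, hs.le⟩
    obtain ⟨K, ε, hε, hK⟩ := hmlip 0 h0
    obtain ⟨M, hM⟩ := isCompact_Icc.exists_bound_of_continuousOn
      (f := fun t => dist (m t) x₀) (fun t ht => (hcont t ht).dist tendsto_const_nhds)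
    refine ⟨max K (M / ε), le_max_of_le_left K.coe_nonneg, fun t ht => ?_⟩
    rcases lt_or_ge t ε with hlt | hge
    · have := hK.dist_le_mul t ⟨hdom ht, by simpa [abs_of_nonneg ht.1] using hlt⟩ 0
        ⟨h0, mem_ball_self hε⟩
      rw [hm0, Real.dist_eq, sub_zero, abs_of_nonneg ht.1] at this
      exact this.trans (mul_le_mul_of_nonneg_right (le_max_left _ _) ht.1)
    · have h1 := hM t ht
      rw [Real.norm_of_nonneg dist_nonneg] at h1
      have hM0 : 0 ≤ M := dist_nonneg.trans h1
      calc dist (m t) x₀ ≤ M := h1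
        _ = M / ε * ε := by field_simp
        _ ≤ M / ε * t := by gcongr
        _ ≤ _ := mul_le_mul_of_nonneg_right (le_max_right _ _) ht.1
  set μ : ℝ := max (-lam) 0 with hμdef
  have hμ : 0 ≤ μ := le_max_right _ _
  have hconv' : LambdaConvex (-μ) F :=
    hconv.mono (by have := le_max_left (-lam) 0; linarith)
  set G : ℝ := 2 * absGradient F x₀ * Real.exp (4 * μ * s) with hG
  have hg := absGradient_nonneg F x₀
  have hG0 : 0 ≤ G := by positivity
  set C : ℝ := L ^ 2 + G ^ 2 + 1 with hCdef
  have hC : 0 < C := by positivity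
  have hsn : Tendsto (fun n : ℕ => s / (n : ℝ)) atTop (nhds 0) :=
    tendsto_const_div_atTop_nhds_zero_nat s
  have hsmall : ∀ᶠ n : ℕ in atTop, 4 * μ * (s / (n : ℝ)) < 1 := by
    have := hsn.const_mul (4 * μ)
    rw [mul_zero] at this
    exact this.eventually_lt_const one_pos
  have hbound : ∀ᶠ n : ℕ in atTop,
      dist (x n n) (m s) ^ 2 ≤ C * Real.exp (2 * μ * s) * (2 * (s / n) * s) := by
    filter_upwards [hsmall, eventually_gt_atTop 0] with n hn hn0
    have hn0' : (0:ℝ) < n := Nat.cast_pos.2 hn0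
    have hh : 0 < s / (n : ℝ) := by positivity
    have hmin := hstep n hh (fun hlam => by
      have hμl : μ = -lam := max_eq_left (by linarith)
      rw [hμl] at hn
      rw [← neg_div_neg_eq (-1), neg_neg, lt_div_iff₀ (by linarith)]
      nlinarith)
    have hiter := hconv'.dist_proximal_iterate_le hX hμ hlip hh hn.le hmin
    rw [hx0 n] at hiter
    have hnh : (n : ℝ) * (s / n) = s := by field_simp
    have key := hconv'.dist_sq_proximal_gradientCurve_le hX hμ hlip hh hC hmin hcont hgrad
      (fun t ht => by
        rw [hx0 n]
        calc dist (m t) x₀ ^ 2 ≤ (L * t) ^ 2 := by gcongr; exact hL t ht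
          _ = L ^ 2 * t ^ 2 := by ring
          _ ≤ C * t ^ 2 := by gcongr; rw [hCdef]; nlinarith [sq_nonneg G])
      (fun i hi => by
        have hi' : (i : ℝ) * (s / n) ≤ s := by
          calc (i : ℝ) * (s / n) ≤ n * (s / n) := by gcongr
            _ = s := hnh
        rw [hm0, dist_comm]
        have h1 : dist (x n i) x₀ ≤ G * (i * (s / n)) := by
          calc dist (x n i) x₀ ≤ _ := hiter i hi
            _ ≤ 2 * absGradient F x₀ * (i * (s / n)) * Real.exp (4 * μ * s) := by gcongr
            _ = _ := by rw [hG]; ring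
        calc dist (x n i) x₀ ^ 2 ≤ (G * (i * (s / n))) ^ 2 := by gcongr
          _ = G ^ 2 * (i * (s / n)) ^ 2 := by ring
          _ ≤ C * (i * (s / n)) ^ 2 := by gcongr; rw [hCdef]; nlinarith [sq_nonneg L])
      n le_rfl s ⟨hs.le, le_rfl⟩
    rw [hnh, sub_self, dist_comm] at key
    simpa using key
  have hlim : Tendsto (fun n : ℕ => C * Real.exp (2 * μ * s) * (2 * (s / (n : ℝ)) * s)) atTop
      (nhds 0) := by
    simpa using ((hsn.const_mul 2).mul_const s).const_mul (C * Real.exp (2 * μ * s))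
  have hsq : Tendsto (fun n : ℕ => dist (x n n) (m s) ^ 2) atTop (nhds 0) :=
    tendsto_of_tendsto_of_tendsto_of_le_of_le' tendsto_const_nhds hlim
      (Eventually.of_forall fun _ => sq_nonneg _) hbound
  rw [tendsto_iff_dist_tendsto_zero]
  have := hsq.sqrt
  simpa [Real.sqrt_sq dist_nonneg] using this
end

section
/- Let X be a complete CAT(0) space and let F : X → ℝ be λ-convex and locally Lipschitz. Let μ₁ and μ₂ be locally Lipschitz gradient curves of F with μ₁(0) = x₁ and μ₂(0) = x₂. Then for every s ≥ 0 at which both curves are defined, d(μ₁(s), μ₂(s)) ≤ e^{−λs} · d(x₁, x₂). In particular, two gradient curves of F with the same initial point coincide. -/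
open Metric Filter

lemma LocLipschitzOn.continuousOn {X Y : Type*} [MetricSpace X] [MetricSpace Y] {f : X → Y}
    {D : Set X} (hf : LocLipschitzOn f D) : ContinuousOn f D := by
  intro t ht
  obtain ⟨K, ε, hε, hK⟩ := hf t ht
  exact (continuousWithinAt_inter (ball_mem_nhds t hε)).1
    (hK.continuousOn t ⟨ht, mem_ball_self hε⟩)

lemma LocallyLipschitz.eventually_sub_le_absGradient {X : Type*} [MetricSpace X] {F : X → ℝ}
    (hF : LocallyLipschitz F) (x : X) {c : ℝ} (hc : absGradient F x < c) :
    ∀ᶠ y in nhds x, F x - F y ≤ c * dist x y := by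
  have hbdd : IsBoundedUnder (· ≤ ·) (nhdsWithin x {x}ᶜ)
      (fun y => (F x - F y) / dist x y) := by
    obtain ⟨K, t, ht, hK⟩ := hF x
    refine ⟨K, ?_⟩
    rw [eventually_map]
    filter_upwards [mem_nhdsWithin_of_mem_nhds ht, self_mem_nhdsWithin] with y hy hne
    have hpos : 0 < dist x y := dist_pos.2 (Ne.symm hne)
    rw [div_le_iff₀ hpos]
    have h := hK.dist_le_mul x (mem_of_mem_nhds ht) y hy
    rw [Real.dist_eq] at h
    exact (le_abs_self _).trans h
  have hlt := eventually_lt_of_limsup_lt (lt_of_le_of_lt (le_max_left _ _) hc) hbdd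
  rw [eventually_nhdsWithin_iff] at hlt
  filter_upwards [hlt] with y hy
  rcases eq_or_ne y x with rfl | hne
  · simp
  · exact ((div_lt_iff₀ (dist_pos.2 hne.symm)).1 (hy hne)).le

/-- The evolution variational inequality for a gradient curve, as an upper bound for the right
derivative of the distance to a fixed point. -/
lemma IsGradientCurveAt.eventually_dist_le {X : Type*} [MetricSpace X] (hX : Cat0 X)
    {lam : ℝ} {F : X → ℝ} (hconv : LambdaConvex lam F) (hlip : LocallyLipschitz F)
    {m : ℝ → X} {t : ℝ} (hm : IsGradientCurveAt F m t) (z : X) (hz : 0 < dist (m t) z) {r : ℝ}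
    (hr : F z - F (m t) - lam / 2 * dist (m t) z ^ 2 < r * dist (m t) z) :
    ∀ᶠ ε in nhdsWithin (0 : ℝ) (Set.Ioi 0),
      dist (m (t + ε)) z ≤ dist (m t) z + ε * r := by
  obtain ⟨hu, hv⟩ := hm
  set x := m t with hx
  set g := absGradient F x
  set D := dist x z with hD
  set A := F z - F x - lam / 2 * D ^ 2 with hA
  obtain ⟨γ, hγ, hγ0, hγ1⟩ := hX.1 x z
  obtain ⟨η, hη, hη_pos, hη_gap⟩ : ∃ η : ℝ, 0 < η ∧ 0 < r + η * D ∧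
      g ^ 2 + η ^ 2 * D ^ 2 + 2 * η * A < (r + η * D) ^ 2 := by
    have h1 := (tendsto_id (α := ℝ) (x := atTop)).atTop_mul_const hz
    have h2 := (tendsto_id (α := ℝ) (x := atTop)).atTop_mul_const (sub_pos.2 hr)
    obtain ⟨η, h0, h1, h2⟩ := ((eventually_gt_atTop 0).and ((h1.eventually_gt_atTop (-r)).and
      (h2.eventually_gt_atTop (g ^ 2)))).exists
    simp only [id] at h1 h2
    exact ⟨η, h0, by linarith, by nlinarith [sq_nonneg r, sq_nonneg g]⟩
  set W := (r + η * D) ^ 2 with hW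
  obtain ⟨s, ⟨hs0, hs1⟩, hs⟩ : ∃ s ∈ Set.Ioo (0 : ℝ) 1,
      g ^ 2 + η ^ 2 * D ^ 2 + 2 * η * A < (1 - s) * W := by
    have h : Tendsto (fun s : ℝ => (1 - s) * W) (nhdsWithin 0 (Set.Ioi 0)) (nhds ((1 - 0) * W)) :=
      (Continuous.tendsto (by fun_prop) _).mono_left nhdsWithin_le_nhds
    rw [sub_zero, one_mul] at h
    obtain ⟨s, h1, h2⟩ := ((h.eventually_const_lt hη_gap).and
      (Ioo_mem_nhdsGT (zero_lt_one' ℝ))).exists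
    exact ⟨s, h2, h1⟩
  obtain ⟨c, hcg, hc⟩ : ∃ c, g < c ∧ (c ^ 2 + (1 - s) * g ^ 2 + s * η ^ 2 * D ^ 2
      - s * (1 - s) * W) / 2 < (1 - s) * g ^ 2 - s * η * A := by
    have h : Tendsto (fun c : ℝ => (c ^ 2 + (1 - s) * g ^ 2 + s * η ^ 2 * D ^ 2
        - s * (1 - s) * W) / 2) (nhdsWithin g (Set.Ioi g)) (nhds ((g ^ 2 + (1 - s) * g ^ 2
        + s * η ^ 2 * D ^ 2 - s * (1 - s) * W) / 2)) :=
      (Continuous.tendsto (by fun_prop) _).mono_left nhdsWithin_le_nhds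
    obtain ⟨c, h1, h2⟩ := ((h.eventually_lt_const (u := (1 - s) * g ^ 2 - s * η * A)
      (by nlinarith)).and self_mem_nhdsWithin).exists
    exact ⟨c, h2, h1⟩
  obtain ⟨ρ, hρ, hslope⟩ :=
    Metric.eventually_nhds_iff.1 (hlip.eventually_sub_le_absGradient x hcg)
  have hε : Tendsto (fun ε : ℝ => ε) (nhdsWithin 0 (Set.Ioi 0)) (nhds 0) :=
    tendsto_id.mono_left nhdsWithin_le_nhds
  have hsmall : Tendsto (fun ε : ℝ => ε * (2 * (dist (m (t + ε)) x / ε) + η * D))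
      (nhdsWithin 0 (Set.Ioi 0)) (nhds (0 * (2 * g + η * D))) :=
    hε.mul ((hu.const_mul 2).add_const _)
  rw [zero_mul] at hsmall
  have hη1 : Tendsto (fun ε : ℝ => η * ε) (nhdsWithin 0 (Set.Ioi 0)) (nhds (η * 0)) :=
    hε.const_mul η
  rw [mul_zero] at hη1
  have hgap : Tendsto (fun ε : ℝ => (1 - s) * (-((F (m (t + ε)) - F x) / ε)) - s * η * A
      - ε * (s * η ^ 2 * (|lam| / 2) * D ^ 2
        + |lam| / 2 * (dist (m (t + ε)) x / ε + η * D) ^ 2)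
      - (c ^ 2 + (1 - s) * (dist (m (t + ε)) x / ε) ^ 2 + s * η ^ 2 * D ^ 2
        - s * (1 - s) * W) / 2) (nhdsWithin 0 (Set.Ioi 0))
      (nhds ((1 - s) * (-(-g ^ 2)) - s * η * A
      - 0 * (s * η ^ 2 * (|lam| / 2) * D ^ 2 + |lam| / 2 * (g + η * D) ^ 2)
      - (c ^ 2 + (1 - s) * g ^ 2 + s * η ^ 2 * D ^ 2 - s * (1 - s) * W) / 2)) :=
    (((hv.neg.const_mul _).sub_const _).sub
      (hε.mul ((((hu.add_const _).pow 2).const_mul _).const_add _))).sub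
      ((((((hu.pow 2).const_mul _).const_add _).add_const _).sub_const _).div_const _)
  filter_upwards [hsmall.eventually_lt_const hρ, hη1.eventually_lt_const zero_lt_one,
    hgap.eventually_const_lt (u := 0) (by linarith), self_mem_nhdsWithin]
    with ε hsmall hη1 hgap hε0
  have hε0 : 0 < ε := hε0
  set p := m (t + ε)
  set u := dist p x / ε with hu_def
  set v := (F p - F x) / ε with hv_def
  have hpx : dist p x = ε * u := by rw [hu_def]; field_simp
  have hFp : F p = F x + ε * v := by rw [hv_def]; field_simp; ring
  have hηε : η * ε ∈ Set.Icc (0 : ℝ) 1 := ⟨by positivity, hη1.le⟩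
  set q := γ (η * ε) with hq
  have hxq : dist x q = η * ε * D := by
    have h := hγ 0 (by simp) _ hηε
    rw [hγ0, hγ1, zero_sub, abs_neg, abs_of_nonneg hηε.1] at h
    exact h
  have hqz : dist q z = (1 - η * ε) * D := by
    have h := hγ _ hηε 1 (by simp)
    rw [hγ0, hγ1, abs_sub_comm, abs_of_nonneg (sub_nonneg.2 hηε.2)] at h
    exact h
  have hFq : F q ≤ F x + η * ε * A + (η * ε) ^ 2 * (lam / 2) * D ^ 2 := by
    have h := hconv γ hγ _ hηε
    rw [hγ0, hγ1] at h
    change F q ≤ _ at h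
    rw [hA]; linarith
  have hu0 : 0 ≤ u := by positivity
  have hpq : dist p q ≤ ε * (u + η * D) := by
    linarith [dist_triangle p x q]
  suffices h : dist p q ≤ ε * (r + η * D) by
    linarith [dist_triangle p q z]
  by_contra! hfar
  obtain ⟨σ, hσ, hσ0, hσ1⟩ := hX.1 p q
  have hsI : s ∈ Set.Icc (0 : ℝ) 1 := ⟨hs0.le, hs1.le⟩
  have hdist := hX.2 x σ hσ s hsI
  have hF := hconv σ hσ s hsI
  have hpy := hσ 0 (by simp) s hsI
  rw [hσ0, hσ1] at hdist hF hpy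
  set y := σ s
  rw [zero_sub, abs_neg, abs_of_pos hs0] at hpy
  have hyx : dist y x < ρ := by
    have h1 := dist_triangle y p x
    rw [dist_comm y p] at h1
    have h2 : s * dist p q ≤ dist p q := mul_le_of_le_one_left dist_nonneg hs1.le
    linarith
  have hFxy := hslope hyx
  have hWε : ε ^ 2 * W ≤ dist p q ^ 2 := by
    rw [hW, ← mul_pow]
    exact pow_le_pow_left₀ (by positivity) hfar.le 2
  have hpq2 : dist p q ^ 2 ≤ ε ^ 2 * (u + η * D) ^ 2 := by
    rw [← mul_pow]
    exact pow_le_pow_left₀ dist_nonneg hpq 2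
  have hdist' : dist x y ^ 2 ≤ ε ^ 2 * ((1 - s) * u ^ 2 + s * η ^ 2 * D ^ 2
      - s * (1 - s) * W) := by
    rw [dist_comm x p, hpx, hxq] at hdist
    have := mul_le_mul_of_nonneg_left hWε (mul_nonneg hs0.le (sub_nonneg.2 hs1.le))
    linarith
  have hcurv : -(s * (1 - s) * (lam / 2) * dist p q ^ 2)
      ≤ |lam| / 2 * (ε ^ 2 * (u + η * D) ^ 2) := by
    have h1 : -(lam / 2) ≤ |lam| / 2 := by linarith [neg_le_abs lam]
    have h2 : s * (1 - s) ≤ 1 :=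
      mul_le_one₀ hs1.le (sub_nonneg.2 hs1.le) (sub_le_self _ hs0.le)
    have h3 : 0 ≤ s * (1 - s) := mul_nonneg hs0.le (sub_nonneg.2 hs1.le)
    calc -(s * (1 - s) * (lam / 2) * dist p q ^ 2)
        = s * (1 - s) * (-(lam / 2)) * dist p q ^ 2 := by ring
      _ ≤ s * (1 - s) * (|lam| / 2) * dist p q ^ 2 := by gcongr
      _ ≤ 1 * (|lam| / 2) * (ε ^ 2 * (u + η * D) ^ 2) := by gcongr
      _ = _ := by ring
  have hlow : F y ≤ F x + (1 - s) * (ε * v) + s * (η * ε * A)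
      + s * ((η * ε) ^ 2 * (|lam| / 2) * D ^ 2) + |lam| / 2 * (ε ^ 2 * (u + η * D) ^ 2) := by
    have h1 : s * F q ≤ s * (F x + η * ε * A + (η * ε) ^ 2 * (|lam| / 2) * D ^ 2) := by
      refine mul_le_mul_of_nonneg_left (hFq.trans ?_) hs0.le
      gcongr
      exact le_abs_self lam
    rw [hFp] at hF
    linarith
  have hamgm : ε * (c * dist x y) ≤ (ε ^ 2 * c ^ 2 + dist x y ^ 2) / 2 := by
    linear_combination sq_nonneg (ε * c - dist x y) / 2
  have h1 := mul_le_mul_of_nonneg_left hFxy hε0.le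
  have h2 := mul_le_mul_of_nonneg_left hlow hε0.le
  refine absurd (mul_pos (pow_pos hε0 2) hgap) (not_lt.2 ?_)
  linear_combination h1 + h2 + hamgm + hdist' / 2

lemma IsGradientCurveAt.eventually_dist_sq_lt {X : Type*} [MetricSpace X] (hX : Cat0 X)
    {lam : ℝ} {F : X → ℝ} (hconv : LambdaConvex lam F) (hlip : LocallyLipschitz F)
    {m n : ℝ → X} {t : ℝ} (hm : IsGradientCurveAt F m t) (hn : IsGradientCurveAt F n t)
    {r : ℝ} (hr : -(2 * lam) * dist (m t) (n t) ^ 2 < r) :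
    ∀ᶠ ε in nhdsWithin (0 : ℝ) (Set.Ioi 0),
      dist (m (t + ε)) (n (t + ε)) ^ 2 - dist (m t) (n t) ^ 2 < r * ε := by
  have hε : Tendsto (fun ε : ℝ => ε) (nhdsWithin 0 (Set.Ioi 0)) (nhds 0) :=
    tendsto_id.mono_left nhdsWithin_le_nhds
  set D := dist (m t) (n t) with hD
  have hD0 : 0 ≤ D := dist_nonneg
  rcases hD0.eq_or_lt with h0 | hpos
  · rw [← h0] at hr ⊢
    have heq : m t = n t := dist_eq_zero.1 h0.symm
    have hlim := hε.mul ((hm.1.add hn.1).pow 2)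
    rw [zero_mul] at hlim
    filter_upwards [hlim.eventually_lt_const (u := r) (by simpa using hr), self_mem_nhdsWithin]
      with ε hlt hε0
    have hε0 : 0 < ε := hε0
    have htri : dist (m (t + ε)) (n (t + ε))
        ≤ dist (m (t + ε)) (m t) + dist (n (t + ε)) (n t) := by
      rw [heq]; exact dist_triangle_right _ _ _
    have hsq := pow_le_pow_left₀ dist_nonneg htri 2
    have := mul_lt_mul_of_pos_right hlt hε0
    have h : ε * (dist (m (t + ε)) (m t) / ε + dist (n (t + ε)) (n t) / ε) ^ 2 * ε
        = (dist (m (t + ε)) (m t) + dist (n (t + ε)) (n t)) ^ 2 := by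
      field_simp
    linarith
  · obtain ⟨γ, hγ, hγ0, hγ1⟩ := hX.1 (m t) (n t)
    have hhalf : (1 / 2 : ℝ) ∈ Set.Icc (0 : ℝ) 1 := by norm_num
    have hF := hconv γ hγ _ hhalf
    have hmz := hγ 0 (by simp) _ hhalf
    have hnz := hγ 1 (by simp) _ hhalf
    rw [hγ0, hγ1, ← hD] at hF hmz hnz
    set z := γ (1 / 2)
    norm_num at hmz hnz
    set σ := (r + 2 * lam * D ^ 2) / (8 * D) with hσ
    have hσ0 : 0 < σ := div_pos (by linarith) (by positivity)
    have hσD : σ * D = (r + 2 * lam * D ^ 2) / 8 := by rw [hσ]; field_simp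
    set A₁ := F z - F (m t) - lam / 2 * (1 / 2 * D) ^ 2 with hA₁
    set A₂ := F z - F (n t) - lam / 2 * (1 / 2 * D) ^ 2 with hA₂
    have key (A : ℝ) : A < (2 * A / D + σ) * (1 / 2 * D) := by
      have : (2 * A / D + σ) * (1 / 2 * D) = A + σ * D / 2 := by field_simp
      rw [this]
      linarith [mul_pos hσ0 hpos]
    have e₁ := hm.eventually_dist_le hX hconv hlip z (by rw [hmz]; positivity)
      (r := 2 * A₁ / D + σ) (by rw [hmz]; exact key A₁)
    have e₂ := hn.eventually_dist_le hX hconv hlip z (by rw [hnz]; positivity)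
      (r := 2 * A₂ / D + σ) (by rw [hnz]; exact key A₂)
    set R := 2 * A₁ / D + σ + (2 * A₂ / D + σ) with hR
    have hRD : 2 * D * R < r := by
      have : 2 * D * R = 4 * (A₁ + A₂) + 4 * (σ * D) := by rw [hR]; field_simp; ring
      rw [this, hσD, hA₁, hA₂]
      linarith
    have hlim := (hε.mul_const (R ^ 2)).const_add (2 * D * R)
    rw [zero_mul, add_zero] at hlim
    filter_upwards [e₁, e₂, hlim.eventually_lt_const hRD, self_mem_nhdsWithin]
      with ε h₁ h₂ hlt hε0
    have htri : dist (m (t + ε)) (n (t + ε)) ≤ D + ε * R := by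
      have := dist_triangle_right (m (t + ε)) (n (t + ε)) z
      rw [hmz] at h₁
      rw [hnz] at h₂
      rw [hR]
      linarith
    have hsq := pow_le_pow_left₀ dist_nonneg htri 2
    have := mul_lt_mul_of_pos_right hlt hε0
    linarith

theorem stmt7 {X : Type*} [MetricSpace X] [CompleteSpace X] (hX : Cat0 X)
    (lam : ℝ) (F : X → ℝ) (hconv : LambdaConvex lam F) (hlip : LocallyLipschitz F)
    (a b : ℝ) (μ₁ μ₂ : ℝ → X) (x₁ x₂ : X)
    (h₁0 : μ₁ 0 = x₁) (h₂0 : μ₂ 0 = x₂)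
    (h₁lip : LocLipschitzOn μ₁ (Set.Ico 0 a)) (h₂lip : LocLipschitzOn μ₂ (Set.Ico 0 b))
    (h₁grad : ∀ t ∈ Set.Ico (0:ℝ) a, IsGradientCurveAt F μ₁ t)
    (h₂grad : ∀ t ∈ Set.Ico (0:ℝ) b, IsGradientCurveAt F μ₂ t) :
    (∀ s : ℝ, 0 ≤ s → s < a → s < b →
      dist (μ₁ s) (μ₂ s) ≤ Real.exp (-lam * s) * dist x₁ x₂) ∧
    (x₁ = x₂ → ∀ s : ℝ, 0 ≤ s → s < a → s < b → μ₁ s = μ₂ s) := by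
  have hmain : ∀ s : ℝ, 0 ≤ s → s < a → s < b →
      dist (μ₁ s) (μ₂ s) ≤ Real.exp (-lam * s) * dist x₁ x₂ := by
    intro s hs hsa hsb
    have hcont : ContinuousOn (fun t => dist (μ₁ t) (μ₂ t) ^ 2) (Set.Icc 0 s) :=
      (continuous_dist.comp_continuousOn
        ((h₁lip.continuousOn.mono (Set.Icc_subset_Ico_right hsa)).prodMk
          (h₂lip.continuousOn.mono (Set.Icc_subset_Ico_right hsb)))).pow 2
    have hgron := le_gronwallBound_of_liminf_deriv_right_le
      (f' := fun t => -(2 * lam) * dist (μ₁ t) (μ₂ t) ^ 2) (δ := dist x₁ x₂ ^ 2)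
      (K := -(2 * lam)) (ε := 0) hcont ?_ (by rw [h₁0, h₂0]) (fun t _ => by simp) s
      (Set.right_mem_Icc.2 hs)
    · rw [gronwallBound_ε0, sub_zero] at hgron
      refine le_of_sq_le_sq ?_ (by positivity)
      rw [mul_pow, ← Real.exp_nat_mul]
      refine hgron.trans_eq ?_
      rw [mul_comm]
      congr 2
      push_cast
      ring
    · intro t ht r hr
      have hev := (h₁grad t ⟨ht.1, ht.2.trans hsa⟩).eventually_dist_sq_lt hX hconv hlip
        (h₂grad t ⟨ht.1, ht.2.trans hsb⟩) hr
      have hshift : Tendsto (fun y : ℝ => y - t) (nhdsWithin t (Set.Ioi t))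
          (nhdsWithin 0 (Set.Ioi 0)) := by
        refine tendsto_nhdsWithin_iff.2 ⟨?_, ?_⟩
        · exact ((continuous_sub_right t).tendsto' _ _ (sub_self t)).mono_left nhdsWithin_le_nhds
        · filter_upwards [self_mem_nhdsWithin] with y hy
          exact sub_pos.2 (Set.mem_Ioi.1 hy)
      refine Eventually.frequently ?_
      filter_upwards [hshift.eventually hev, self_mem_nhdsWithin] with y hy hty
      rw [add_sub_cancel] at hy
      rw [inv_mul_lt_iff₀ (sub_pos.2 (Set.mem_Ioi.1 hty))]
      linarith
  refine ⟨hmain, fun h s hs hsa hsb => ?_⟩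
  have := hmain s hs hsa hsb
  rw [h, dist_self, mul_zero] at this
  exact dist_le_zero.1 this
end
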